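/- Suppose Y = F (so n = t(l+1)), H(S̄) = F_{q^t}, and 2m = t − 1 (so Orb(S) is an r-FWS code with r = tl − 1). Then ω_{2i}(Orb(S)) = (q+1)·q^{2i−1} for every i ∈ {1,…,m−1}, ω_{2m}(Orb(S)) = (q^t − q^{2m−1})/(q − 1), and ω_{2(m+1)}(Orb(S)) = (q^n − q^t)/(q − 1). -/

import Mathlib

open Module

section Defs

variable {F : Type*} [Field F]

/-- The subspace `α·S = {α * s : s ∈ S}` of `F`, for `S` a subspace over the subfield `Fq`. -/
noncomputable def smulSub (Fq : Subfield F) (α : F) (S : Submodule Fq F) : Submodule Fq F :=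
  S.map (LinearMap.mulLeft Fq α)

/-- The one-orbit cyclic subspace code `Orb(S) = {αS : α ∈ Fˣ}`. -/
def Orb (Fq : Subfield F) (S : Submodule Fq F) : Set (Submodule Fq F) :=
  {T | ∃ α : F, α ≠ 0 ∧ T = smulSub Fq α S}

/-- The number of subspaces `αS` (for `α ∈ Fˣ`) with `dim_{Fq}(S ∩ αS) = d`.
For `dim_{Fq} S = k` and `d = k - i` this is the weight-distribution entry `ω_{2i}(Orb S)`. -/
noncomputable def wt (Fq : Subfield F) (S : Submodule Fq F) (d : ℕ) : ℕ :=
  Set.ncard {T | T ∈ Orb Fq S ∧ finrank Fq ↥(S ⊓ T) = d}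

/-- The stabilizer `H(V) = {x ∈ Fˣ : xV = V} ∪ {0}` of a set `V ⊆ F`. -/
def HStabSet (V : Set F) : Set F :=
  {x : F | x ≠ 0 ∧ (fun y => x * y) '' V = V} ∪ {0}

/-- An `Fqt`-subspace of `F` viewed as an `Fq`-subspace, for `Fq ≤ Fqt`. -/
def toFqSub (Fq Fqt : Subfield F) (h : Fq ≤ Fqt) (W : Submodule Fqt F) : Submodule Fq F where
  carrier := W
  add_mem' := fun ha hb => W.add_mem ha hb
  zero_mem' := W.zero_mem
  smul_mem' := fun c _ hx => W.smul_mem (⟨c.1, h c.2⟩ : Fqt) hx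

/-- The subfield `Fqt` viewed as an `Fq`-subspace of `F`, for `Fq ≤ Fqt`. -/
def subfieldModule (Fq Fqt : Subfield F) (h : Fq ≤ Fqt) : Submodule Fq F where
  carrier := Fqt
  add_mem' := fun ha hb => Fqt.add_mem ha hb
  zero_mem' := Fqt.zero_mem
  smul_mem' := fun c _ hx => Fqt.mul_mem (h c.2) hx

/-- `Orb(S)` is an `r`-FWS code, where `k = dim_{Fq} S`: the weight-distribution entries
`ω_{2i}` are positive for `i ∈ {1, …, k - r}` and zero for `i ∈ {k - r + 1, …, k}`. -/
def IsRFWS (Fq : Subfield F) (S : Submodule Fq F) (k r : ℕ) : Prop :=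
  (∀ i, 1 ≤ i → i ≤ k - r → 0 < wt Fq S (k - i)) ∧
  (∀ i, k - r + 1 ≤ i → i ≤ k → wt Fq S (k - i) = 0)

end Defs

section PowerSpaces

open Polynomial

variable {F : Type*} [Field F]

/-- The `Fq`-span of `1, lam, …, lam ^ (r - 1)`, as the values at `lam` of the polynomials of
degree less than `r`. -/
noncomputable def powerSpace (Fq : Subfield F) (lam : F) (r : ℕ) : Submodule Fq F :=
  (degreeLT Fq r).map (aeval lam).toLinearMap

lemma mem_powerSpace {Fq : Subfield F} {lam : F} {r : ℕ} {x : F} :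
    x ∈ powerSpace Fq lam r ↔ ∃ p : Fq[X], p.degree < r ∧ aeval lam p = x := by
  simp [powerSpace, mem_degreeLT]

lemma powerSpace_mono (Fq : Subfield F) (lam : F) {r s : ℕ} (h : r ≤ s) :
    powerSpace Fq lam r ≤ powerSpace Fq lam s :=
  Submodule.map_mono (degreeLT_mono h)

lemma span_pow_eq_powerSpace (Fq : Subfield F) (lam : F) (m : ℕ) :
    Submodule.span Fq {x : F | ∃ j < m, x = lam ^ j} = powerSpace Fq lam m := by
  classical
  rw [powerSpace, degreeLT_eq_span_X_pow, Submodule.map_span]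
  congr 1
  ext x
  simp [eq_comm]

lemma powerSpace_subset {Fq K : Subfield F} (hle : Fq ≤ K) {lam : F} (hmem : lam ∈ K) {r : ℕ}
    {x : F} (hx : x ∈ powerSpace Fq lam r) : x ∈ K := by
  obtain ⟨p, -, rfl⟩ := mem_powerSpace.1 hx
  rw [aeval_eq_sum_range]
  exact sum_mem fun j _ => K.mul_mem (hle (p.coeff j).2) (pow_mem hmem j)

lemma mem_smulSub {Fq : Subfield F} {α : F} (hα : α ≠ 0) {S : Submodule Fq F} {x : F} :
    x ∈ smulSub Fq α S ↔ α⁻¹ * x ∈ S := by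
  simp only [smulSub, Submodule.mem_map, LinearMap.mulLeft_apply]
  constructor
  · rintro ⟨y, hy, rfl⟩
    rwa [inv_mul_cancel_left₀ hα]
  · exact fun h => ⟨_, h, mul_inv_cancel_left₀ hα x⟩

lemma eq_zero_of_aeval_eq_zero_of_degree_lt {Fq : Subfield F} {lam : F} {p : Fq[X]}
    (hp : p.degree < (minpoly Fq lam).natDegree) (h : aeval lam p = 0) : p = 0 := by
  by_contra hne
  rw [← natDegree_lt_iff_degree_lt hne] at hp
  exact absurd (natDegree_le_natDegree (minpoly.degree_le_of_ne_zero Fq lam hne h)) (by omega)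

/-- If `α = f(lam) / g(lam)` in lowest terms, then the intersection of `⟨1, …, lam ^ (r - 1)⟩`
with its multiple by `α` is `f(lam) ⟨1, …, lam ^ (r - i - 1)⟩`, where `i = max (deg f) (deg g)`. -/
lemma finrank_powerSpace_inf_of_isCoprime {Fq : Subfield F} {lam : F} {f g : Fq[X]}
    (hfg : IsCoprime f g) {α : F} (hα : α ≠ 0) (hf : f ≠ 0)
    (h : aeval lam f = α * aeval lam g) {r : ℕ}
    (hr : max f.natDegree g.natDegree + r ≤ (minpoly Fq lam).natDegree) (hr0 : 0 < r) :
    finrank Fq ↥(powerSpace Fq lam r ⊓ smulSub Fq α (powerSpace Fq lam r)) =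
      r - max f.natDegree g.natDegree := by
  set i := max f.natDegree g.natDegree with hi
  have hfi : f.natDegree ≤ i := le_max_left _ _
  have hgi : g.natDegree ≤ i := le_max_right _ _
  have hfl : aeval lam f ≠ 0 := fun h0 => hf <| eq_zero_of_aeval_eq_zero_of_degree_lt
    (degree_le_natDegree.trans_lt (by exact_mod_cast by omega)) h0
  let T : Fq[X] →ₗ[Fq] F := (LinearMap.mulLeft Fq (aeval lam f)).comp (aeval lam).toLinearMap
  have hT : ∀ p, T p = aeval lam f * aeval lam p := fun p => rfl
  have hdeg : ∀ {p : Fq[X]} {k : ℕ}, p ≠ 0 → (p.degree < k ↔ p.natDegree < k) :=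
    fun hp => (natDegree_lt_iff_degree_lt hp).symm
  have key : powerSpace Fq lam r ⊓ smulSub Fq α (powerSpace Fq lam r) =
      (degreeLT Fq (r - i)).map T := by
    ext x
    simp only [Submodule.mem_inf, mem_smulSub hα, mem_powerSpace, Submodule.mem_map, mem_degreeLT,
      hT]
    constructor
    · rintro ⟨⟨v, hv, rfl⟩, u, hu, huv⟩
      by_cases hv0 : v = 0
      · exact ⟨0, by simp, by simp [hv0]⟩
      have huv' : aeval lam v = α * aeval lam u := by rw [huv, mul_inv_cancel_left₀ hα]
      have hdeg_mul : ∀ {a c : Fq[X]}, a.natDegree ≤ i → c.degree < r →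
          (a * c).degree < (minpoly Fq lam).natDegree := by
        intro a c ha hc
        by_cases hac : a * c = 0
        · rw [hac, degree_zero]; exact WithBot.bot_lt_coe _
        have hc0 : c ≠ 0 := right_ne_zero_of_mul hac
        rw [hdeg hac]
        rw [hdeg hc0] at hc
        exact natDegree_mul_le.trans_lt (by omega)
      have hz : g * v - f * u = 0 := by
        refine eq_zero_of_aeval_eq_zero_of_degree_lt (lam := lam)
          ((degree_sub_le _ _).trans_lt (max_lt (hdeg_mul hgi hv) (hdeg_mul hfi hu))) ?_
        rw [map_sub, map_mul, map_mul, h, huv']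
        ring
      have hz' : g * v = f * u := sub_eq_zero.1 hz
      obtain ⟨p, rfl⟩ : f ∣ v := hfg.dvd_of_dvd_mul_left ⟨u, hz'⟩
      have hup : u = g * p := by
        apply mul_left_cancel₀ hf
        rw [← hz']; ring
      have hp0 : p ≠ 0 := right_ne_zero_of_mul hv0
      refine ⟨p, ?_, by simp⟩
      rw [hdeg hv0, natDegree_mul hf hp0] at hv
      rw [hdeg hp0]
      by_cases hg0 : g = 0
      · simp [hg0] at hi; omega
      rw [hup, hdeg (mul_ne_zero hg0 hp0), natDegree_mul hg0 hp0] at hu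
      omega
    · rintro ⟨p, hp, rfl⟩
      have hdeg_mul : ∀ {a : Fq[X]}, a.natDegree ≤ i → (a * p).degree < r := by
        intro a ha
        by_cases hac : a * p = 0
        · rw [hac, degree_zero]; exact WithBot.bot_lt_coe _
        rw [hdeg hac]
        rw [hdeg (right_ne_zero_of_mul hac)] at hp
        exact natDegree_mul_le.trans_lt (by omega)
      refine ⟨⟨f * p, hdeg_mul hfi, by simp⟩, g * p, hdeg_mul hgi, ?_⟩
      rw [map_mul, h, mul_assoc, inv_mul_cancel_left₀ hα]
  have hinj : Function.Injective (T.domRestrict (degreeLT Fq (r - i))) := by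
    rw [← LinearMap.ker_eq_bot, LinearMap.ker_eq_bot']
    rintro ⟨p, hp⟩ hp0
    rw [mem_degreeLT] at hp
    have : aeval lam p = 0 := by simpa [hT, hfl] using hp0
    have hp1 := eq_zero_of_aeval_eq_zero_of_degree_lt
      (hp.trans_le (by exact_mod_cast by omega)) this
    exact Subtype.ext hp1
  rw [key, ← LinearMap.range_domRestrict, LinearMap.finrank_range_of_inj hinj,
    (degreeLTEquiv Fq (r - i)).finrank_eq, finrank_fin_fun]

lemma finrank_powerSpace {Fq : Subfield F} {lam : F} {r : ℕ}
    (hr : r ≤ (minpoly Fq lam).natDegree) : finrank Fq ↥(powerSpace Fq lam r) = r := by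
  rcases Nat.eq_zero_or_pos r with rfl | hr0
  · have : powerSpace Fq lam 0 = ⊥ := by
      rw [eq_bot_iff]
      intro x hx
      obtain ⟨p, hp, rfl⟩ := mem_powerSpace.1 hx
      have : p = 0 := by
        by_contra h
        rw [← natDegree_lt_iff_degree_lt h] at hp
        omega
      simp [this]
    rw [this, finrank_bot]
  · have h := finrank_powerSpace_inf_of_isCoprime (Fq := Fq) (lam := lam) (f := 1) (g := 1)
      isCoprime_one_left one_ne_zero one_ne_zero (by simp) (r := r) (by simpa) hr0
    have h1 : smulSub Fq 1 (powerSpace Fq lam r) = powerSpace Fq lam r := by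
      ext x; simp [mem_smulSub]
    rw [h1, inf_idem] at h
    simpa using h

/-- If `P ∩ αP ≠ 0` for `P = ⟨1, …, lam ^ (m - 1)⟩`, then all the intersections of this kind are
governed by the degree `i` of `α` as a rational function of `lam`. -/
lemma exists_finrank_powerSpace_inf_eq {Fq : Subfield F} {lam : F} {m : ℕ} {α : F} (hα : α ≠ 0)
    (hm : 2 * m ≤ (minpoly Fq lam).natDegree)
    (h : finrank Fq ↥(powerSpace Fq lam m ⊓ smulSub Fq α (powerSpace Fq lam m)) ≠ 0) :
    ∃ i < m, ∀ r, 0 < r → r ≤ m →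
      finrank Fq ↥(powerSpace Fq lam r ⊓ smulSub Fq α (powerSpace Fq lam r)) = r - i := by
  classical
  have hne : powerSpace Fq lam m ⊓ smulSub Fq α (powerSpace Fq lam m) ≠ ⊥ := by
    intro h0
    rw [h0, finrank_bot] at h
    exact h rfl
  obtain ⟨x, hx, hx0⟩ := Submodule.exists_mem_ne_zero_of_ne_bot hne
  rw [Submodule.mem_inf, mem_smulSub hα, mem_powerSpace, mem_powerSpace] at hx
  obtain ⟨⟨v, hv, rfl⟩, u, hu, huv⟩ := hx
  have hv0 : v ≠ 0 := by rintro rfl; simp at hx0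
  have hu0 : u ≠ 0 := by
    rintro rfl
    rw [map_zero, eq_comm] at huv
    exact mul_ne_zero (inv_ne_zero hα) hx0 huv
  rw [← natDegree_lt_iff_degree_lt hv0] at hv
  rw [← natDegree_lt_iff_degree_lt hu0] at hu
  obtain ⟨f, hf⟩ := EuclideanDomain.gcd_dvd_left v u
  obtain ⟨g, hg⟩ := EuclideanDomain.gcd_dvd_right v u
  set d := EuclideanDomain.gcd v u
  have hd0 : d ≠ 0 := by rintro h0; rw [h0, zero_mul] at hf; exact hv0 hf
  have hf0 : f ≠ 0 := by rintro h0; rw [h0, mul_zero] at hf; exact hv0 hf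
  have hg0 : g ≠ 0 := by rintro h0; rw [h0, mul_zero] at hg; exact hu0 hg
  have hcop : IsCoprime f g := by
    have e : d = v * EuclideanDomain.gcdA v u + u * EuclideanDomain.gcdB v u :=
      EuclideanDomain.gcd_eq_gcd_ab v u
    refine ⟨EuclideanDomain.gcdA v u, EuclideanDomain.gcdB v u, ?_⟩
    apply mul_left_cancel₀ hd0
    calc d * (EuclideanDomain.gcdA v u * f + EuclideanDomain.gcdB v u * g)
        = (d * f) * EuclideanDomain.gcdA v u + (d * g) * EuclideanDomain.gcdB v u := by ring
      _ = d * 1 := by rw [← hf, ← hg, mul_one]; exact e.symm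
  have hfd : f.natDegree < m := by rw [hf, natDegree_mul hd0 hf0] at hv; omega
  have hgd : g.natDegree < m := by rw [hg, natDegree_mul hd0 hg0] at hu; omega
  have hdl : aeval lam d ≠ 0 := by
    intro h0
    rw [hf, map_mul, h0, zero_mul] at hx0
    exact hx0 rfl
  have hfg : aeval lam f = α * aeval lam g := by
    apply mul_left_cancel₀ hdl
    rw [mul_left_comm, ← map_mul, ← map_mul, ← hf, ← hg, huv, mul_inv_cancel_left₀ hα]
  exact ⟨_, max_lt hfd hgd, fun r hr0 hr =>
    finrank_powerSpace_inf_of_isCoprime hcop hα hf0 hfg (by omega) hr0⟩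

/-- The multiplier `lam ^ i + c` shifts `⟨1, …, lam ^ (m - 1)⟩` by exactly `i`. -/
lemma finrank_powerSpace_inf_pow_add {Fq : Subfield F} {lam : F} {m i : ℕ} (hi0 : 0 < i)
    (him : i ≤ m) (hm : 2 * m ≤ (minpoly Fq lam).natDegree) (c : Fq)
    (hα : lam ^ i + (c : F) ≠ 0) :
    finrank Fq ↥(powerSpace Fq lam m ⊓
      smulSub Fq (lam ^ i + (c : F)) (powerSpace Fq lam m)) = m - i := by
  have h := finrank_powerSpace_inf_of_isCoprime (Fq := Fq) (lam := lam) (f := X ^ i + C c) (g := 1)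
    isCoprime_one_right hα (X_pow_add_C_ne_zero hi0 c) (by simp; rfl) (r := m)
    (by simp; omega) (by omega)
  simpa using h

lemma eq_of_pow_add_eq_mul {Fq : Subfield F} {lam : F} {i : ℕ} (hi0 : 0 < i)
    (hi : i < (minpoly Fq lam).natDegree) {c c' s : Fq}
    (h : lam ^ i + (c : F) = s * (lam ^ i + (c' : F))) : c = c' := by
  have hp : (C (1 - s) * X ^ i + C (c - s * c') : Fq[X]) = 0 := by
    refine eq_zero_of_aeval_eq_zero_of_degree_lt (lam := lam) ?_ ?_
    · refine (degree_add_le _ _).trans_lt (max_lt ?_ ?_)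
      · exact (degree_C_mul_X_pow_le _ _).trans_lt (by exact_mod_cast hi)
      · exact degree_C_le.trans_lt (by exact_mod_cast by omega)
    · have : ∀ a : Fq, algebraMap Fq F a = (a : F) := fun _ => rfl
      simp only [map_add, map_mul, aeval_C, map_pow, aeval_X, this]
      push_cast
      linear_combination h
  have h1 := congrArg (fun p => coeff p i) hp
  have h0 := congrArg (fun p => coeff p 0) hp
  simp only [coeff_add, coeff_C_mul, coeff_X_pow, coeff_C, coeff_zero, hi0.ne', hi0.ne, if_true,
    if_false, mul_one, mul_zero, add_zero, zero_add] at h1 h0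
  have hs : s = 1 := (sub_eq_zero.1 h1).symm
  rw [hs, one_mul] at h0
  exact sub_eq_zero.1 h0

lemma pow_add_ne_zero {Fq : Subfield F} {lam : F} {i : ℕ} (hi0 : 0 < i)
    (hi : i < (minpoly Fq lam).natDegree) (c : Fq) : lam ^ i + (c : F) ≠ 0 := by
  intro h
  have := eq_of_pow_add_eq_mul (c := c) (c' := c + 1) (s := 0) hi0 hi (by rw [h]; simp)
  simp at this

/-- The multipliers fixing `⟨1, …, lam ^ (m - 1)⟩` are scalars. -/
lemma mem_of_powerSpace_le_smulSub {Fq : Subfield F} {lam : F} {m : ℕ} {α : F} (hα : α ≠ 0)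
    (hm0 : 0 < m) (hm : 2 * m ≤ (minpoly Fq lam).natDegree)
    (h : powerSpace Fq lam m ≤ smulSub Fq α (powerSpace Fq lam m)) : α ∈ Fq := by
  have hfin : finrank Fq ↥(powerSpace Fq lam m ⊓ smulSub Fq α (powerSpace Fq lam m)) = m := by
    rw [inf_eq_left.2 h, finrank_powerSpace (by omega)]
  obtain ⟨i, him, hi⟩ := exists_finrank_powerSpace_inf_eq hα hm (by omega)
  have h1 := hi 1 one_pos hm0
  have h2 := hi m hm0 le_rfl
  have hne : powerSpace Fq lam 1 ⊓ smulSub Fq α (powerSpace Fq lam 1) ≠ ⊥ := by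
    intro h0
    rw [h0, finrank_bot] at h1
    omega
  obtain ⟨x, hx, hx0⟩ := Submodule.exists_mem_ne_zero_of_ne_bot hne
  have hone : ∀ y, y ∈ powerSpace Fq lam 1 → y ∈ Fq := by
    intro y hy
    obtain ⟨p, hp, rfl⟩ := mem_powerSpace.1 hy
    rw [eq_C_of_degree_le_zero (Order.lt_succ_iff.1 hp), aeval_C]
    exact (p.coeff 0).2
  rw [Submodule.mem_inf, mem_smulSub hα] at hx
  have h3 := Fq.mul_mem (hone _ hx.2) (Fq.inv_mem (hone _ hx.1))
  rw [mul_assoc, mul_inv_cancel₀ hx0, mul_one] at h3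
  simpa using Fq.inv_mem h3

end PowerSpaces

universe u

lemma rank_comap_of_le_range {k : Type*} {V W : Type u} [Field k] [AddCommGroup V] [Module k V]
    [AddCommGroup W] [Module k W] (f : V →ₗ[k] W) {U : Submodule k W}
    (hU : U ≤ LinearMap.range f) :
    Module.rank k ↥(U.comap f) = Module.rank k U + Module.rank k ↥(LinearMap.ker f) := by
  let g : ↥(U.comap f) →ₗ[k] U := f.restrict fun x hx => hx
  have hg : Function.Surjective g := by
    rintro ⟨y, hy⟩
    obtain ⟨x, rfl⟩ := hU hy
    exact ⟨⟨x, hy⟩, rfl⟩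
  have hle : LinearMap.ker f ≤ U.comap f := fun x hx => by
    rw [Submodule.mem_comap, LinearMap.mem_ker.1 hx]
    exact U.zero_mem
  have hker : LinearMap.ker g = (LinearMap.ker f).comap (U.comap f).subtype := by
    ext x
    simp [g, LinearMap.restrict_apply, Subtype.ext_iff]
  rw [LinearMap.rank_eq_of_surjective hg, hker,
    (Submodule.comapSubtypeEquivOfLe hle).rank_eq]

section RankAdd

variable {k : Type*} {U V W : Type u} [Field k] [AddCommGroup U] [Module k U] [AddCommGroup V]
  [Module k V] [AddCommGroup W] [Module k W]

lemma finite_and_finite_of_rank_eq_add (h0 : 0 < finrank k U)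
    (h : Module.rank k U = Module.rank k V + Module.rank k W) :
    Module.Finite k V ∧ Module.Finite k W := by
  have := Module.finite_of_finrank_pos h0
  have hlt := rank_lt_aleph0 k U
  rwa [h, Cardinal.add_lt_aleph0_iff, Module.rank_lt_aleph0_iff, Module.rank_lt_aleph0_iff] at hlt

lemma finrank_eq_add_of_rank_eq_add [Module.Finite k V] [Module.Finite k W]
    (h : Module.rank k U = Module.rank k V + Module.rank k W) :
    finrank k U = finrank k V + finrank k W := by
  rw [finrank, h, Cardinal.toNat_add (rank_lt_aleph0 _ _) (rank_lt_aleph0 _ _)]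
  rfl

end RankAdd

section Coordinates

variable {F : Type*} [Field F] {Fq K : Subfield F}

/-- A `K`-linear functional, viewed as an `Fq`-linear endomorphism of `F`. -/
def coordMap (hle : Fq ≤ K) (φ : F →ₗ[K] K) : F →ₗ[Fq] F where
  toFun x := φ x
  map_add' x y := by simp
  map_smul' c x := congrArg Subtype.val (φ.map_smul ⟨c.1, hle c.2⟩ x)

/-- The pair of functionals `x ↦ (φ x, φ (α⁻¹ x))`. -/
def pairMap (hle : Fq ≤ K) (φ : F →ₗ[K] K) (α : F) : F →ₗ[Fq] F × F :=
  (coordMap hle φ).prod ((coordMap hle φ).comp (LinearMap.mulLeft Fq α⁻¹))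

@[simp] lemma coordMap_apply (hle : Fq ≤ K) (φ : F →ₗ[K] K) (x : F) :
    coordMap hle φ x = φ x := rfl

@[simp] lemma pairMap_apply (hle : Fq ≤ K) (φ : F →ₗ[K] K) (α x : F) :
    pairMap hle φ α x = ((φ x : F), (φ (α⁻¹ * x) : F)) := rfl

lemma apply_mul_of_mem (φ : F →ₗ[K] K) {c : F} (hc : c ∈ K) (x : F) :
    (φ (c * x) : F) = c * φ x :=
  congrArg Subtype.val (φ.map_smul ⟨c, hc⟩ x)

lemma smulSub_smulSub (α β : F) (S : Submodule Fq F) :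
    smulSub Fq α (smulSub Fq β S) = smulSub Fq (α * β) S := by
  ext x
  simp [smulSub]

lemma smulSub_one (S : Submodule Fq F) : smulSub Fq 1 S = S := by
  ext x
  simp [mem_smulSub]

lemma smulSub_of_mem {c : F} (hc : c ∈ Fq) (hc0 : c ≠ 0) (S : Submodule Fq F) :
    smulSub Fq c S = S := by
  ext x
  rw [mem_smulSub hc0]
  exact S.smul_mem_iff (s := (⟨c⁻¹, Fq.inv_mem hc⟩ : Fq))
    (fun h => inv_ne_zero hc0 (congrArg Subtype.val h))

lemma rank_inf_smulSub_of_notMem (hle : Fq ≤ K) (φ : F →ₗ[K] K) {P S : Submodule Fq F}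
    (hP : ∀ x ∈ P, x ∈ K) (hS : ∀ x, x ∈ S ↔ (φ x : F) ∈ P) {α : F} (hα : α ≠ 0)
    (hsurj : ∀ c d : K, ∃ x, φ x = c ∧ φ (α⁻¹ * x) = d) :
    Module.rank Fq ↥(S ⊓ smulSub Fq α S) =
      Module.rank Fq ↥(P.prod P) + Module.rank Fq ↥(LinearMap.ker (pairMap hle φ α)) := by
  have h : S ⊓ smulSub Fq α S = (P.prod P).comap (pairMap hle φ α) := by
    ext x
    simp [mem_smulSub hα, hS]
  rw [h, rank_comap_of_le_range]
  rintro ⟨c, d⟩ ⟨hc, hd⟩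
  obtain ⟨x, hx, hx'⟩ := hsurj ⟨c, hP c hc⟩ ⟨d, hP d hd⟩
  exact ⟨x, by simp [hx, hx']⟩

lemma rank_inf_smulSub_of_mem (hle : Fq ≤ K) (φ : F →ₗ[K] K) {P S : Submodule Fq F}
    (hP : ∀ x ∈ P, x ∈ K) (hS : ∀ x, x ∈ S ↔ (φ x : F) ∈ P) {α : F} (hα : α ≠ 0) (hαK : α ∈ K)
    {b : F} (hb : φ b = 1) :
    Module.rank Fq ↥(S ⊓ smulSub Fq α S) =
      Module.rank Fq ↥(P ⊓ smulSub Fq α P) + Module.rank Fq ↥(LinearMap.ker (coordMap hle φ)) := by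
  have h : S ⊓ smulSub Fq α S = (P ⊓ smulSub Fq α P).comap (coordMap hle φ) := by
    ext x
    simp [mem_smulSub hα, hS, apply_mul_of_mem φ (K.inv_mem hαK)]
  rw [h, rank_comap_of_le_range]
  rintro c ⟨hc, -⟩
  exact ⟨c * b, by simp [apply_mul_of_mem φ (hP c hc), hb]⟩

/-- The orbit map `α ↦ αS` has the scalars as its stabilizer. -/
lemma div_mem_of_smulSub_eq (φ : F →ₗ[K] K) {P S : Submodule Fq F}
    (hP : ∀ x ∈ P, x ∈ K) (hS : ∀ x, x ∈ S ↔ (φ x : F) ∈ P) {b : F} (hb : φ b = 1)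
    (hsurj : ∀ α ∉ K, ∀ c d : K, ∃ x, φ x = c ∧ φ (α⁻¹ * x) = d)
    (hPK : ∃ x ∈ K, x ∉ P) (hstab : ∀ α ≠ 0, P ≤ smulSub Fq α P → α ∈ Fq)
    {α β : F} (hα : α ≠ 0) (hβ : β ≠ 0) (h : smulSub Fq α S = smulSub Fq β S) :
    α / β ∈ Fq := by
  have hγ : α / β ≠ 0 := div_ne_zero hα hβ
  have hfix : smulSub Fq (α / β) S = S := by
    rw [div_eq_inv_mul, ← smulSub_smulSub, h, smulSub_smulSub, inv_mul_cancel₀ hβ, smulSub_one]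
  have hiff : ∀ x, (φ x : F) ∈ P ↔ (φ ((α / β)⁻¹ * x) : F) ∈ P := by
    intro x
    rw [← hS, ← hS, ← mem_smulSub hγ, hfix]
  by_cases hK : α / β ∈ K
  · refine hstab _ hγ fun c hc => ?_
    have h1 := hiff (c * b)
    rw [apply_mul_of_mem φ (K.inv_mem hK), apply_mul_of_mem φ (hP c hc), hb] at h1
    rw [mem_smulSub hγ]
    simpa using h1.1 (by simpa using hc)
  · exfalso
    obtain ⟨k, hk, hkP⟩ := hPK
    obtain ⟨x, hx, hx'⟩ := hsurj _ hK 0 ⟨k, hk⟩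
    have h1 := (hiff x).1 (by rw [hx]; exact P.zero_mem)
    rw [hx'] at h1
    exact hkP h1

end Coordinates

section Infinite

variable {F : Type*} [Field F] {Fq K : Subfield F}

/-- Over an infinite base field the relevant part of the orbit is empty or infinite. -/
lemma wt_eq_zero_of_infinite [Infinite Fq] (hle : Fq ≤ K) {lam : F} (hmem : lam ∈ K) {m : ℕ}
    (hm0 : 0 < m) (hm : 2 * m < (minpoly Fq lam).natDegree) (φ : F →ₗ[K] K)
    {S : Submodule Fq F} (hS : ∀ x, x ∈ S ↔ (φ x : F) ∈ powerSpace Fq lam m)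
    {b : F} (hb : φ b = 1)
    (hsurj : ∀ α ∉ K, ∀ c d : K, ∃ x, φ x = c ∧ φ (α⁻¹ * x) = d)
    (hdiv : ∀ α β : F, α ≠ 0 → β ≠ 0 → smulSub Fq α S = smulSub Fq β S → α / β ∈ Fq)
    {d : ℕ} (hd0 : d ≠ 0)
    (hd : Module.Finite Fq ↥(LinearMap.ker (coordMap hle φ)) →
      d < m + finrank Fq ↥(LinearMap.ker (coordMap hle φ))) :
    wt Fq S d = 0 := by
  have hP : ∀ x ∈ powerSpace Fq lam m, x ∈ K := fun x hx => powerSpace_subset hle hmem hx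
  have hinf : ∀ (i : ℕ) (α : F), 0 < i → i ≤ m → α ≠ 0 →
      (∀ c : Fq, finrank Fq ↥(S ⊓ smulSub Fq ((lam ^ i + (c : F)) * α) S) = d) →
      wt Fq S d = 0 := by
    intro i α hi0 him hα h
    have hne : ∀ c : Fq, (lam ^ i + (c : F)) * α ≠ 0 := fun c =>
      mul_ne_zero (pow_add_ne_zero hi0 (by omega) c) hα
    refine Set.Infinite.ncard (Set.infinite_of_injective_forall_mem
      (f := fun c : Fq => smulSub Fq ((lam ^ i + (c : F)) * α) S) ?_ ?_)
    · intro c c' hcc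
      have h1 := hdiv _ _ (hne c) (hne c') hcc
      rw [mul_div_mul_right _ _ hα] at h1
      refine eq_of_pow_add_eq_mul (lam := lam) (s := ⟨_, h1⟩) hi0 (by omega) ?_
      exact (div_mul_cancel₀ _ (pow_add_ne_zero hi0 (by omega : i < (minpoly Fq lam).natDegree) c')).symm
    · exact fun c => ⟨⟨_, hne c, rfl⟩, h c⟩
  rcases Set.eq_empty_or_nonempty {T | T ∈ Orb Fq S ∧ finrank Fq ↥(S ⊓ T) = d} with he | hne
  · rw [wt, he, Set.ncard_empty]
  obtain ⟨T, ⟨α, hα, rfl⟩, hT⟩ := hne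
  by_cases hαK : α ∈ K
  · have hr := rank_inf_smulSub_of_mem hle φ hP hS hα hαK hb
    obtain ⟨hfin1, hfin2⟩ := finite_and_finite_of_rank_eq_add (by rw [hT]; omega) hr
    have hfr : ∀ β : F, β ≠ 0 → β ∈ K →
        Module.Finite Fq ↥(powerSpace Fq lam m ⊓ smulSub Fq β (powerSpace Fq lam m)) →
        finrank Fq ↥(S ⊓ smulSub Fq β S) =
          finrank Fq ↥(powerSpace Fq lam m ⊓ smulSub Fq β (powerSpace Fq lam m)) +
            finrank Fq ↥(LinearMap.ker (coordMap hle φ)) := by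
      intro β hβ hβK hfβ
      exact finrank_eq_add_of_rank_eq_add (rank_inf_smulSub_of_mem hle φ hP hS hβ hβK hb)
    have hfP : Module.Finite Fq ↥(powerSpace Fq lam m) :=
      Module.finite_of_finrank_pos (by rw [finrank_powerSpace (by omega)]; exact hm0)
    have h1 := hfr α hα hαK hfin1
    have h2 := hd hfin2
    have hlam : ∀ c : Fq, lam ^ (m - finrank Fq ↥(powerSpace Fq lam m ⊓
        smulSub Fq α (powerSpace Fq lam m))) + (c : F) ≠ 0 :=
      fun c => pow_add_ne_zero (by omega) (by omega) c
    refine hinf (m - finrank Fq ↥(powerSpace Fq lam m ⊓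
      smulSub Fq α (powerSpace Fq lam m))) 1 (by omega) (by omega) one_ne_zero fun c => ?_
    rw [mul_one, hfr _ (hlam c) (K.add_mem (pow_mem hmem _) (hle c.2))
      (Submodule.finiteDimensional_inf_left _ _),
      finrank_powerSpace_inf_pow_add (by omega) (by omega) hm.le c (hlam c)]
    omega
  · refine hinf 1 α one_pos hm0 hα fun c => ?_
    have hc : lam ^ 1 + (c : F) ≠ 0 := pow_add_ne_zero one_pos (by omega) c
    have hcK : lam ^ 1 + (c : F) ∈ K := K.add_mem (pow_mem hmem _) (hle c.2)
    have hβK : (lam ^ 1 + (c : F)) * α ∉ K := fun h => hαK <| by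
      have h1 := K.mul_mem (K.inv_mem hcK) h
      rwa [inv_mul_cancel_left₀ hc] at h1
    have hker : LinearMap.ker (pairMap hle φ ((lam ^ 1 + (c : F)) * α)) =
        LinearMap.ker (pairMap hle φ α) := by
      ext x
      have := apply_mul_of_mem φ (K.inv_mem hcK) (α⁻¹ * x)
      rw [← mul_assoc, ← mul_inv] at this
      rw [LinearMap.mem_ker, LinearMap.mem_ker, pairMap_apply, pairMap_apply, this,
        Prod.mk_eq_zero, Prod.mk_eq_zero, mul_eq_zero, or_iff_right (inv_ne_zero hc)]
    rw [← hT, finrank, finrank,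
      rank_inf_smulSub_of_notMem hle φ hP hS (mul_ne_zero hc hα) (hsurj _ hβK), hker,
      rank_inf_smulSub_of_notMem hle φ hP hS hα (hsurj _ hαK)]

end Infinite

section Counting

open Finset

variable {F : Type*} [Field F] {Fq K : Subfield F}

lemma card_filter_finrank_eq_mul_wt [Fintype F] [DecidableEq F] {S : Submodule Fq F}
    (hdiv : ∀ α β : F, α ≠ 0 → β ≠ 0 → smulSub Fq α S = smulSub Fq β S → α / β ∈ Fq) (d : ℕ) :
    #{α : F | α ≠ 0 ∧ finrank Fq ↥(S ⊓ smulSub Fq α S) = d} = (Nat.card Fq - 1) * wt Fq S d := by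
  classical
  have : Finite (Submodule Fq F) := Finite.of_injective _ SetLike.coe_injective
  have : Fintype (Submodule Fq F) := Fintype.ofFinite _
  have : Fintype Fq := Fintype.ofFinite _
  rw [wt, Set.ncard_eq_toFinset_card', card_eq_sum_card_fiberwise (f := fun α => smulSub Fq α S)
    (t := {T | T ∈ Orb Fq S ∧ finrank Fq ↥(S ⊓ T) = d}.toFinset), sum_const_nat, mul_comm]
  · intro T hT
    obtain ⟨⟨α, hα, rfl⟩, hd⟩ := Set.mem_toFinset.1 hT
    rw [← Nat.card_units, Nat.card_eq_fintype_card, ← card_univ]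
    symm
    refine card_bij (fun c _ => ((c : Fq) : F) * α) ?_ ?_ ?_
    · intro c _
      have hc : ((c : Fq) : F) ≠ 0 := fun h => c.ne_zero (Subtype.ext h)
      have he : smulSub Fq (((c : Fq) : F) * α) S = smulSub Fq α S := by
        rw [← smulSub_smulSub, smulSub_of_mem (c : Fq).2 hc]
      rw [mem_filter, mem_filter]
      exact ⟨⟨mem_univ _, mul_ne_zero hc hα, by rw [he]; exact hd⟩, he⟩
    · intro c _ c' _ h
      exact Units.ext (Subtype.ext (mul_right_cancel₀ hα h))
    · intro β hβ
      simp only [mem_filter, mem_univ, true_and] at hβ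
      have h1 := hdiv β α hβ.1.1 hα hβ.2
      have h0 : β / α ≠ 0 := div_ne_zero hβ.1.1 hα
      exact ⟨Units.mk0 ⟨_, h1⟩ (fun h => h0 (congrArg Subtype.val h)), mem_univ _,
        div_mul_cancel₀ β hα⟩
  · intro α hα
    simp only [coe_filter, mem_univ, true_and, Set.mem_ofPred_eq] at hα
    simp only [Set.coe_toFinset, Set.mem_ofPred_eq]
    exact ⟨⟨α, hα.1, rfl⟩, hα.2⟩

lemma card_filter_mem_ne_zero [Fintype F] [DecidableEq F] (V : Submodule Fq F)
    [DecidablePred (· ∈ V)] :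
    #{x : F | x ∈ V ∧ x ≠ 0} = Nat.card Fq ^ finrank Fq V - 1 := by
  have h1 : ({x : F | x ∈ V ∧ x ≠ 0} : Finset F) = ({x : F | x ∈ V} : Finset F).erase 0 := by
    ext x; simp [and_comm]
  rw [h1, card_erase_of_mem (by simp [V.zero_mem]), ← Module.natCard_eq_pow_finrank (K := Fq) (V := V),
    Nat.card_eq_fintype_card, Fintype.card_subtype]

lemma sum_pow_finrank_inf_smulSub [Fintype F] [DecidableEq F] [DecidablePred (· ∈ K)]
    {P : Submodule Fq F} (hP : ∀ x ∈ P, x ∈ K) :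
    ∑ α : F with α ≠ 0 ∧ α ∈ K, (Nat.card Fq ^ finrank Fq ↥(P ⊓ smulSub Fq α P) - 1) =
      (Nat.card Fq ^ finrank Fq P - 1) ^ 2 := by
  classical
  rw [sq, ← card_filter_mem_ne_zero, ← card_product,
    card_eq_sum_card_fiberwise (f := fun p : F × F => p.1 / p.2)
      (t := ({α : F | α ≠ 0 ∧ α ∈ K} : Finset F))]
  · refine sum_congr rfl fun α hα => ?_
    simp only [mem_filter, mem_univ, true_and] at hα
    rw [← card_filter_mem_ne_zero]
    refine card_bij (fun v _ => (v, α⁻¹ * v)) ?_ ?_ ?_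
    · intro v hv
      simp only [mem_filter, mem_univ, true_and, Submodule.mem_inf, mem_smulSub hα.1] at hv
      obtain ⟨⟨h1, h2⟩, h3⟩ := hv
      simp [h1, h2, h3, hα.1]
      field_simp
    · intro v _ v' _ h
      exact congrArg Prod.fst h
    · rintro ⟨v, u⟩ h
      simp only [mem_filter, mem_product, mem_univ, true_and] at h
      obtain ⟨⟨⟨h1, h2⟩, h3, h4⟩, rfl⟩ := h
      have : (v / u)⁻¹ * v = u := by field_simp
      refine ⟨v, ?_, by rw [this]⟩
      rw [mem_filter, Submodule.mem_inf, mem_smulSub hα.1, this]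
      exact ⟨mem_univ _, ⟨h1, h3⟩, h2⟩
  · rintro ⟨v, u⟩ h
    simp only [coe_product, coe_filter, mem_univ, true_and, Set.mem_prod, Set.mem_ofPred_eq] at h ⊢
    exact ⟨div_ne_zero h.1.2 h.2.2, K.div_mem (hP _ h.1.1) (hP _ h.2.1)⟩

/-- The number of nonzero rational functions of degree at most `r` in `lam`. -/
lemma card_powerSpace_inf_ne_zero [Fintype F] [DecidableEq F] [DecidablePred (· ∈ K)]
    (hle : Fq ≤ K) {lam : F} (hmem : lam ∈ K) {m : ℕ}
    (hm : 2 * m ≤ (minpoly Fq lam).natDegree) {r : ℕ} (hr : r + 1 ≤ m) :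
    (#{α : F | (α ≠ 0 ∧ α ∈ K) ∧ finrank Fq ↥(powerSpace Fq lam (r + 1) ⊓
      smulSub Fq α (powerSpace Fq lam (r + 1))) ≠ 0} : ℤ) = (Nat.card Fq : ℤ) ^ (2 * r + 1) - 1 := by
  set q := Nat.card Fq with hq
  have hq2 : 1 < q := Finite.one_lt_card
  let D : ℕ → F → ℕ := fun s α =>
    finrank Fq ↥(powerSpace Fq lam s ⊓ smulSub Fq α (powerSpace Fq lam s))
  have hsum : ∀ s ≤ m, ∑ α : F with α ≠ 0 ∧ α ∈ K, ((q : ℤ) ^ D s α - 1) = ((q : ℤ) ^ s - 1) ^ 2 := by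
    intro s hs
    have h := sum_pow_finrank_inf_smulSub (K := K) (P := powerSpace Fq lam s)
      fun x hx => powerSpace_subset hle hmem hx
    rw [finrank_powerSpace (by omega), ← hq] at h
    have h' := congrArg (Nat.cast : ℕ → ℤ) h
    have hp : ∀ k, 1 ≤ q ^ k := fun k => Nat.one_le_pow _ _ (by omega)
    push_cast [hp] at h'
    exact h'
  have hstep : ∀ α : F, α ≠ 0 → D (r + 1) α ≠ 0 → D (r + 1) α = D r α + 1 := by
    intro α hα h
    obtain ⟨i, hi, hD⟩ := exists_finrank_powerSpace_inf_eq hα (m := r + 1) (by omega) h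
    have h1 : D (r + 1) α = r + 1 - i := hD (r + 1) (by omega) le_rfl
    rcases Nat.eq_zero_or_pos r with rfl | hr0
    · have : D 0 α ≤ finrank Fq ↥(powerSpace Fq lam 0) := Submodule.finrank_mono inf_le_left
      rw [finrank_powerSpace (by omega)] at this
      omega
    · have h2 : D r α = r - i := hD r hr0 (by omega)
      omega
  have hzero : ∀ α : F, D (r + 1) α = 0 → D r α = 0 := by
    intro α h
    have : D r α ≤ D (r + 1) α := Submodule.finrank_mono (inf_le_inf
      (powerSpace_mono Fq lam (by omega)) (Submodule.map_mono (powerSpace_mono Fq lam (by omega))))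
    omega
  have hdiff : ∑ α : F with α ≠ 0 ∧ α ∈ K, ((q : ℤ) ^ D (r + 1) α - 1) =
      ∑ α : F with α ≠ 0 ∧ α ∈ K,
        ((q : ℤ) * ((q : ℤ) ^ D r α - 1) + if D (r + 1) α ≠ 0 then ((q : ℤ) - 1) else 0) := by
    refine sum_congr rfl fun α hα => ?_
    simp only [mem_filter, mem_univ, true_and] at hα
    by_cases h : D (r + 1) α = 0
    · simp [h, hzero α h]
    · rw [if_pos h, hstep α hα.1 h]
      ring
  rw [sum_add_distrib, ← mul_sum, hsum _ hr, hsum r (by omega), ← sum_filter, filter_filter,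
    sum_const, nsmul_eq_mul] at hdiff
  have hq0 : (q : ℤ) - 1 ≠ 0 := by
    have : (1 : ℤ) < q := by exact_mod_cast hq2
    omega
  apply mul_right_cancel₀ hq0
  linear_combination -hdiff

end Counting

section Setup

variable {F : Type*} [Field F] {Fq K : Subfield F}

lemma exists_functional (hle : Fq ≤ K) {Sbar : Submodule K F} {b : F} (hb : b ≠ 0)
    (hbint : {x : F | ∃ c ∈ K, x = b * c} ∩ (Sbar : Set F) = {0})
    (hY : toFqSub Fq K hle Sbar ⊔ smulSub Fq b (subfieldModule Fq K hle) = ⊤) :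
    ∃ φ : F →ₗ[K] K, φ b = 1 ∧ ∀ x, φ x = 0 ↔ x ∈ Sbar := by
  have hbS : b ∉ Sbar := fun h => hb <| by
    have : b ∈ ({0} : Set F) := hbint ▸ ⟨⟨1, K.one_mem, (mul_one b).symm⟩, h⟩
    exact this
  obtain ⟨f, hf, hker⟩ := Submodule.exists_le_ker_of_notMem hbS
  have hb1 : ((f b)⁻¹ • f) b = 1 := by simp [hf]
  have hS0 : ∀ x ∈ Sbar, ((f b)⁻¹ • f) x = 0 := fun x hx => by
    simp [LinearMap.mem_ker.1 (hker hx)]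
  refine ⟨(f b)⁻¹ • f, hb1, fun x => ⟨fun hx => ?_, hS0 x⟩⟩
  obtain ⟨s, hs, y, hy, rfl⟩ := Submodule.mem_sup.1 (hY ▸ Submodule.mem_top : x ∈ _)
  obtain ⟨c, hc, rfl⟩ := hy
  have h1 : (((f b)⁻¹ • f) (b * c) : F) = c := by
    rw [mul_comm, apply_mul_of_mem _ hc, hb1]
    simp
  rw [map_add, hS0 s hs, zero_add] at hx
  have hc0 : c = 0 := h1.symm.trans (congrArg Subtype.val hx)
  rw [hc0, map_zero, add_zero]
  exact hs

lemma mem_sup_smulSub_iff (hle : Fq ≤ K) {Sbar : Submodule K F} {b : F} {φ : F →ₗ[K] K}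
    (hb : φ b = 1) (hφ : ∀ x, φ x = 0 ↔ x ∈ Sbar) {P : Submodule Fq F} (hP : ∀ x ∈ P, x ∈ K)
    (x : F) : x ∈ toFqSub Fq K hle Sbar ⊔ smulSub Fq b P ↔ (φ x : F) ∈ P := by
  rw [Submodule.mem_sup]
  constructor
  · rintro ⟨s, hs, y, ⟨c, hc, rfl⟩, rfl⟩
    have h1 : (φ (b * c) : F) = c := by
      rw [mul_comm, apply_mul_of_mem _ (hP c hc), hb]
      simp
    have hs0 : φ s = 0 := (hφ s).2 hs
    rw [map_add, hs0, zero_add]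
    exact h1.symm ▸ hc
  · intro h
    refine ⟨x - b * φ x, ?_, b * φ x, ⟨_, h, rfl⟩, sub_add_cancel _ _⟩
    refine (hφ _).1 (Subtype.ext ?_)
    rw [map_sub, mul_comm, AddSubgroupClass.coe_sub, apply_mul_of_mem _ (φ x).2, hb]
    simp

lemma mem_of_forall_mul_mem {Sbar : Submodule K F} [Module.Finite K Sbar]
    (hH : HStabSet (Sbar : Set F) = (K : Set F)) {α : F} (hα : α ≠ 0)
    (h : ∀ x ∈ Sbar, α * x ∈ Sbar) : α ∈ K := by
  have hmap : Sbar.map (LinearMap.mulLeft K α) = Sbar := by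
    apply Submodule.eq_of_le_of_finrank_eq
    · rintro _ ⟨x, hx, rfl⟩
      exact h x hx
    · exact (Submodule.equivMapOfInjective _ (mul_right_injective₀ hα) Sbar).finrank_eq.symm
  have : α ∈ HStabSet (Sbar : Set F) := Or.inl ⟨hα, by
    conv_rhs => rw [← hmap]
    rfl⟩
  rw [hH] at this
  exact this

lemma exists_apply_eq_and_apply_inv_mul_eq {Sbar : Submodule K F} [Module.Finite K Sbar]
    (hH : HStabSet (Sbar : Set F) = (K : Set F)) {φ : F →ₗ[K] K}
    (hφ : ∀ x, φ x = 0 ↔ x ∈ Sbar) {α : F} (hα : α ∉ K) (c d : K) :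
    ∃ x, φ x = c ∧ φ (α⁻¹ * x) = d := by
  have hα0 : α ≠ 0 := fun h => hα (h ▸ K.zero_mem)
  have h1 : ∃ x, φ x = 0 ∧ φ (α⁻¹ * x) ≠ 0 := by
    by_contra! hcon
    have := mem_of_forall_mul_mem hH (inv_ne_zero hα0) fun x hx =>
      (hφ _).1 (hcon x ((hφ x).2 hx))
    exact hα (by simpa using K.inv_mem this)
  have h2 : ∃ y, φ y ≠ 0 ∧ φ (α⁻¹ * y) = 0 := by
    by_contra! hcon
    refine hα (mem_of_forall_mul_mem hH hα0 fun x hx => ?_)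
    by_contra hx'
    refine hcon (α * x) (fun h => hx' ((hφ _).1 h)) ?_
    rw [inv_mul_cancel_left₀ hα0]
    exact (hφ x).2 hx
  obtain ⟨x, hx0, hx⟩ := h1
  obtain ⟨y, hy, hy0⟩ := h2
  refine ⟨(d / φ (α⁻¹ * x)) • x + (c / φ y) • y, ?_, ?_⟩
  · rw [map_add, map_smul, map_smul, hx0, smul_zero, zero_add, smul_eq_mul, div_mul_cancel₀ _ hy]
  · rw [mul_add, mul_smul_comm, mul_smul_comm, map_add, map_smul, map_smul, hy0, smul_zero,
      add_zero, smul_eq_mul, div_mul_cancel₀ _ hx]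

lemma natDegree_mul_finrank_le (hle : Fq ≤ K) {lam : F} (hmem : lam ∈ K)
    (hlam : 0 < (minpoly Fq lam).natDegree)
    {Sbar : Submodule K F} [Module.Finite K Sbar] {φ : F →ₗ[K] K} (hφ : ∀ x, φ x = 0 ↔ x ∈ Sbar)
    [Module.Finite Fq ↥(LinearMap.ker (coordMap hle φ))] :
    (minpoly Fq lam).natDegree * finrank K Sbar ≤
      finrank Fq ↥(LinearMap.ker (coordMap hle φ)) := by
  set t := (minpoly Fq lam).natDegree
  let e := finBasis K Sbar
  let P := powerSpace Fq lam t
  have hP : ∀ x ∈ P, x ∈ K := fun x hx => powerSpace_subset hle hmem hx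
  have hPt : finrank Fq P = t := finrank_powerSpace le_rfl
  have hfin : Module.Finite Fq P := Module.finite_of_finrank_pos (by omega)
  let T : (Fin (finrank K Sbar) → P) →ₗ[Fq] F :=
    ∑ i, (LinearMap.mulRight Fq ((e i : Sbar) : F)).comp (P.subtype.comp (LinearMap.proj i))
  have hT : ∀ p, T p = ∑ i, ((p i : P) : F) * ((e i : Sbar) : F) := fun p => by
    simp [T, LinearMap.sum_apply]
  have hTe : ∀ p, T p = ((∑ i, (⟨(p i : F), hP _ (p i).2⟩ : K) • e i : Sbar) : F) := fun p => by
    rw [hT, AddSubmonoidClass.coe_finsetSum]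
    rfl
  have hTker : ∀ p, T p ∈ LinearMap.ker (coordMap hle φ) := fun p => by
    rw [LinearMap.mem_ker, coordMap_apply, (hφ _).2 (by rw [hTe]; exact Subtype.property _)]
    rfl
  have hinj : Function.Injective (T.codRestrict _ hTker) := by
    rw [← LinearMap.ker_eq_bot, LinearMap.ker_eq_bot']
    intro p hp
    have h0 : T p = 0 := congrArg Subtype.val hp
    rw [hTe] at h0
    have h1 := Fintype.linearIndependent_iff.1 e.linearIndependent _ (Subtype.ext h0)
    funext i
    exact Subtype.ext (congrArg (Subtype.val : K → F) (h1 i))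
  have := LinearMap.finrank_le_finrank_of_injective hinj
  rwa [finrank_pi_fintype, Finset.sum_const, Finset.card_univ, Fintype.card_fin, hPt, smul_eq_mul,
    mul_comm] at this

lemma finrank_submodule_prod (P : Submodule Fq F) [Module.Finite Fq P] :
    finrank Fq ↥(P.prod P) = 2 * finrank Fq P := by
  let e : ↥(P.prod P) ≃ₗ[Fq] P × P :=
    { toFun x := (⟨x.1.1, x.2.1⟩, ⟨x.1.2, x.2.2⟩)
      invFun y := ⟨(y.1, y.2), y.1.2, y.2.2⟩
      map_add' _ _ := rfl
      map_smul' _ _ := rfl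
      left_inv _ := rfl
      right_inv _ := rfl }
  rw [e.finrank_eq, finrank_prod, two_mul]

end Setup

section FiniteCase

open Finset

variable {F : Type*} [Field F] {Fq K : Subfield F}

lemma finrank_subfieldModule [Finite F] (hle : Fq ≤ K) {t : ℕ}
    (hK : Nat.card K = Nat.card Fq ^ t) : finrank Fq ↥(subfieldModule Fq K hle) = t := by
  have h := Module.natCard_eq_pow_finrank (K := Fq) (V := ↥(subfieldModule Fq K hle))
  have hc : Nat.card ↥(subfieldModule Fq K hle) = Nat.card K := rfl
  rw [hc, hK] at h
  exact (Nat.pow_right_injective Finite.one_lt_card h).symm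

lemma finrank_ker_coordMap [Finite F] (hle : Fq ≤ K) {φ : F →ₗ[K] K} {b : F} (hb : φ b = 1) :
    finrank Fq F = finrank Fq ↥(subfieldModule Fq K hle) +
      finrank Fq ↥(LinearMap.ker (coordMap hle φ)) := by
  refine finrank_eq_add_of_rank_eq_add ?_
  rw [← rank_comap_of_le_range (coordMap hle φ)]
  · have : (subfieldModule Fq K hle).comap (coordMap hle φ) = ⊤ :=
      eq_top_iff.2 fun x _ => (φ x).2
    rw [this, rank_top]
  · intro c hc
    exact ⟨c * b, by rw [coordMap_apply, apply_mul_of_mem φ hc, hb]; simp⟩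

lemma finrank_ker_pairMap [Finite F] (hle : Fq ≤ K) {φ : F →ₗ[K] K} {α : F}
    (hsurj : ∀ c d : K, ∃ x, φ x = c ∧ φ (α⁻¹ * x) = d) :
    finrank Fq F = 2 * finrank Fq ↥(subfieldModule Fq K hle) +
      finrank Fq ↥(LinearMap.ker (pairMap hle φ α)) := by
  rw [← finrank_submodule_prod]
  refine finrank_eq_add_of_rank_eq_add ?_
  rw [← rank_comap_of_le_range (pairMap hle φ α)]
  · have : ((subfieldModule Fq K hle).prod (subfieldModule Fq K hle)).comap
        (pairMap hle φ α) = ⊤ := eq_top_iff.2 fun x _ => ⟨(φ x).2, (φ (α⁻¹ * x)).2⟩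
    rw [this, rank_top]
  · rintro ⟨c, d⟩ ⟨hc, hd⟩
    obtain ⟨x, hx, hx'⟩ := hsurj ⟨c, hc⟩ ⟨d, hd⟩
    exact ⟨x, by rw [pairMap_apply, hx, hx']⟩

/-- The number of `α ∈ Kˣ` of degree exactly `i` as a rational function of `lam`. -/
lemma card_finrank_powerSpace_inf_eq [Fintype F] [DecidableEq F] [DecidablePred (· ∈ K)]
    (hle : Fq ≤ K) {lam : F} (hmem : lam ∈ K) {m : ℕ}
    (hm : 2 * m ≤ (minpoly Fq lam).natDegree) {i : ℕ} (hi0 : 0 < i) (hi : i < m) :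
    (#{α : F | (α ≠ 0 ∧ α ∈ K) ∧ finrank Fq ↥(powerSpace Fq lam m ⊓
      smulSub Fq α (powerSpace Fq lam m)) = m - i} : ℤ) =
      (Nat.card Fq : ℤ) ^ (2 * i + 1) - (Nat.card Fq : ℤ) ^ (2 * i - 1) := by
  let D : ℕ → F → ℕ := fun s α =>
    finrank Fq ↥(powerSpace Fq lam s ⊓ smulSub Fq α (powerSpace Fq lam s))
  have hmono : ∀ α : F, ∀ s ≤ m, D s α ≤ D m α := fun α s hs =>
    Submodule.finrank_mono (inf_le_inf (powerSpace_mono Fq lam hs)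
      (Submodule.map_mono (powerSpace_mono Fq lam hs)))
  have hD : ∀ α : F, α ≠ 0 → (D (i + 1) α ≠ 0 ↔ D m α = m - i ∨ D i α ≠ 0) ∧
      ¬ (D m α = m - i ∧ D i α ≠ 0) := by
    intro α hα
    by_cases h : D m α = 0
    · have h1 := hmono α i hi.le
      have h2 := hmono α (i + 1) hi
      omega
    · obtain ⟨j, hj, hDj⟩ := exists_finrank_powerSpace_inf_eq hα hm h
      have h1 : D i α = i - j := hDj i hi0 hi.le
      have h2 : D (i + 1) α = i + 1 - j := hDj (i + 1) (by omega) hi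
      have h3 : D m α = m - j := hDj m (by omega) le_rfl
      omega
  have hA := card_powerSpace_inf_ne_zero hle hmem hm (r := i) hi
  have hB := card_powerSpace_inf_ne_zero hle hmem hm (r := i - 1) (by omega)
  rw [Nat.sub_add_cancel hi0, show 2 * (i - 1) + 1 = 2 * i - 1 by omega] at hB
  have hunion : ({α : F | (α ≠ 0 ∧ α ∈ K) ∧ D (i + 1) α ≠ 0} : Finset F) =
      ({α : F | (α ≠ 0 ∧ α ∈ K) ∧ D m α = m - i} : Finset F) ∪
        ({α : F | (α ≠ 0 ∧ α ∈ K) ∧ D i α ≠ 0} : Finset F) := by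
    rw [← filter_or]
    refine filter_congr fun α _ => ?_
    rw [← and_or_left]
    exact and_congr_right fun h => (hD α h.1).1
  have hdisj : Disjoint ({α : F | (α ≠ 0 ∧ α ∈ K) ∧ D m α = m - i} : Finset F)
      ({α : F | (α ≠ 0 ∧ α ∈ K) ∧ D i α ≠ 0} : Finset F) := by
    rw [disjoint_filter]
    exact fun α _ h h' => (hD α h.1.1).2 ⟨h.2, h'.2⟩
  have hcard := congrArg (Nat.cast : ℕ → ℤ) (congrArg card hunion)
  rw [card_union_of_disjoint hdisj, Nat.cast_add] at hcard
  linear_combination hA - hB - hcard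

/-- The number of `α ∈ Kˣ` that are not of degree less than `m` as a rational function of `lam`. -/
lemma card_finrank_powerSpace_inf_eq_zero [Fintype F] [DecidableEq F] [DecidablePred (· ∈ K)]
    (hle : Fq ≤ K) {lam : F} (hmem : lam ∈ K) {m : ℕ} (hm0 : 0 < m)
    (hm : 2 * m ≤ (minpoly Fq lam).natDegree) :
    (#{α : F | (α ≠ 0 ∧ α ∈ K) ∧ finrank Fq ↥(powerSpace Fq lam m ⊓
      smulSub Fq α (powerSpace Fq lam m)) = 0} : ℤ) =
      (Nat.card K : ℤ) - (Nat.card Fq : ℤ) ^ (2 * m - 1) := by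
  have hB := card_powerSpace_inf_ne_zero hle hmem hm (r := m - 1) (by omega)
  rw [Nat.sub_add_cancel hm0, show 2 * (m - 1) + 1 = 2 * m - 1 by omega] at hB
  have hK : #{α : F | α ≠ 0 ∧ α ∈ K} + 1 = Nat.card K := by
    have h1 : ({α : F | α ≠ 0 ∧ α ∈ K} : Finset F) = ({α : F | α ∈ K} : Finset F).erase 0 := by
      ext x; simp
    rw [h1, card_erase_add_one (by simp [K.zero_mem]), Nat.card_eq_fintype_card,
      Fintype.card_subtype]
  have hsplit := card_filter_add_card_filter_not (s := ({α : F | α ≠ 0 ∧ α ∈ K} : Finset F))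
    fun α => finrank Fq ↥(powerSpace Fq lam m ⊓ smulSub Fq α (powerSpace Fq lam m)) = 0
  rw [filter_filter, filter_filter] at hsplit
  have hsplit' := congrArg (Nat.cast : ℕ → ℤ) hsplit
  rw [Nat.cast_add] at hsplit'
  have hK' := congrArg (Nat.cast : ℕ → ℤ) hK
  rw [Nat.cast_add, Nat.cast_one] at hK'
  linear_combination hsplit' - hB + hK'

end FiniteCase

/-- suppose `Y = F`, `H(S̄) = F_{q^t}` and `2m = t - 1` (the case `r = tl - 1`).
Then `ω_{2i} = (q+1)q^{2i-1}` for `i ∈ {1, …, m-1}`, `ω_{2m} = (q^t - q^{2m-1})/(q-1)` and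
`ω_{2(m+1)} = (q^n - q^t)/(q-1)`. -/
theorem stmt13 (q n : ℕ) (hn : 0 < n)
    (F : Type*) [Field F] (hF : Nat.card F = q ^ n)
    (Fq Fqt : Subfield F) (hq : Nat.card Fq = q) (hle : Fq ≤ Fqt)
    (lam : F) (hlam : lam ∉ Fq) (hmem : lam ∈ Fqt)
    (t : ℕ) (ht : t = (minpoly Fq lam).natDegree) (hqt : Nat.card Fqt = q ^ t)
    (l : ℕ) (hl : 0 < l)
    (Sbar : Submodule Fqt F) (hSbar : finrank Fqt Sbar = l)
    (b : F) (hb : b ≠ 0)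
    (hbint : {x : F | ∃ c ∈ Fqt, x = b * c} ∩ (Sbar : Set F) = {0})
    (m : ℕ) (hm1 : 0 < m) (hm2 : m < t)
    (Sm : Submodule Fq F) (hSm : Sm = Submodule.span Fq {x : F | ∃ j < m, x = lam ^ j})
    (S : Submodule Fq F) (hS : S = toFqSub Fq Fqt hle Sbar ⊔ smulSub Fq b Sm)
    (Y : Submodule Fq F)
    (hY : Y = toFqSub Fq Fqt hle Sbar ⊔ smulSub Fq b (subfieldModule Fq Fqt hle))
    (hYtop : Y = ⊤) (hnt : n = t * (l + 1))
    (hHSbar : HStabSet (Sbar : Set F) = (Fqt : Set F))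
    (hm : 2 * m + 1 = t) :
    (∀ i : ℕ, 1 ≤ i → i ≤ m - 1 →
        wt Fq S (t * l + m - i) = (q + 1) * q ^ (2 * i - 1)) ∧
      (wt Fq S (t * l) : ℚ) = ((q : ℚ) ^ t - (q : ℚ) ^ (2 * m - 1)) / ((q : ℚ) - 1) ∧
      (wt Fq S (t * l - 1) : ℚ) = ((q : ℚ) ^ n - (q : ℚ) ^ t) / ((q : ℚ) - 1) := by
  classical
  subst hY hSm ht
  rw [span_pow_eq_powerSpace] at hS
  have hP : ∀ x ∈ powerSpace Fq lam m, x ∈ Fqt := fun x hx => powerSpace_subset hle hmem hx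
  have hfinS : Module.Finite Fqt Sbar := Module.finite_of_finrank_pos (by omega)
  obtain ⟨φ, hφb, hφ⟩ := exists_functional hle hb hbint hYtop
  have hSmem : ∀ x, x ∈ S ↔ (φ x : F) ∈ powerSpace Fq lam m := fun x => by
    rw [hS]
    exact mem_sup_smulSub_iff hle hφb hφ hP x
  have hsurj : ∀ α ∉ Fqt, ∀ c d : Fqt, ∃ x, φ x = c ∧ φ (α⁻¹ * x) = d := fun α hα c d =>
    exists_apply_eq_and_apply_inv_mul_eq hHSbar hφ hα c d
  set t := (minpoly Fq lam).natDegree with ht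
  have hPK : ∃ x ∈ Fqt, x ∉ powerSpace Fq lam m := by
    by_contra! hcon
    have h1 : powerSpace Fq lam (m + 1) ≤ powerSpace Fq lam m := fun x hx =>
      hcon x (powerSpace_subset hle hmem hx)
    have hm' : finrank Fq ↥(powerSpace Fq lam m) = m := finrank_powerSpace (by omega)
    have : Module.Finite Fq ↥(powerSpace Fq lam m) := Module.finite_of_finrank_pos (by omega)
    have h2 := Submodule.finrank_mono h1
    rw [finrank_powerSpace (by omega)] at h2
    omega
  have hdiv : ∀ α β : F, α ≠ 0 → β ≠ 0 → smulSub Fq α S = smulSub Fq β S → α / β ∈ Fq :=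
    fun α β hα hβ h => div_mem_of_smulSub_eq φ hP hSmem hφb hsurj hPK
      (fun γ hγ hle' => mem_of_powerSpace_le_smulSub hγ hm1 (by omega) hle') hα hβ h
  have htl : t ≤ t * l := Nat.le_mul_of_pos_right t hl
  rcases finite_or_infinite Fq with hfq | hfq
  · have hq2 : 1 < q := hq ▸ Finite.one_lt_card
    have hFfin : Finite F := Nat.finite_of_card_ne_zero (by rw [hF]; positivity)
    have : Fintype F := Fintype.ofFinite F
    have hKt : finrank Fq ↥(subfieldModule Fq Fqt hle) = t :=
      finrank_subfieldModule hle (by rw [hqt, hq])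
    have hFn : finrank Fq F = n := by
      have h := Module.natCard_eq_pow_finrank (K := Fq) (V := F)
      rw [hF, hq] at h
      exact (Nat.pow_right_injective hq2 h).symm
    have hnt' : n = t * l + t := by rw [hnt]; ring
    have hin : ∀ α : F, α ≠ 0 → α ∈ Fqt → finrank Fq ↥(S ⊓ smulSub Fq α S) =
        finrank Fq ↥(powerSpace Fq lam m ⊓ smulSub Fq α (powerSpace Fq lam m)) + t * l := by
      intro α hα hαK
      have h1 := finrank_eq_add_of_rank_eq_add
        (rank_inf_smulSub_of_mem hle φ hP hSmem hα hαK hφb)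
      have h2 := finrank_ker_coordMap hle hφb
      omega
    have hout : ∀ α : F, α ∉ Fqt → finrank Fq ↥(S ⊓ smulSub Fq α S) = t * l - 1 := by
      intro α hαK
      have hα : α ≠ 0 := fun h => hαK (h ▸ Fqt.zero_mem)
      have h1 := finrank_eq_add_of_rank_eq_add
        (rank_inf_smulSub_of_notMem hle φ hP hSmem hα (hsurj α hαK))
      rw [finrank_submodule_prod, finrank_powerSpace (by omega)] at h1
      have h2 := finrank_ker_pairMap hle (hsurj α hαK)
      omega
    have hwt : ∀ d, ((q : ℤ) - 1) * (wt Fq S d : ℤ) =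
        (Finset.card {α : F | α ≠ 0 ∧ finrank Fq ↥(S ⊓ smulSub Fq α S) = d} : ℤ) := by
      intro d
      rw [card_filter_finrank_eq_mul_wt hdiv d, hq]
      push_cast [hq2.le]
      rfl
    have hset : ∀ j, ({α : F | α ≠ 0 ∧ finrank Fq ↥(S ⊓ smulSub Fq α S) = t * l + j} : Finset F) =
        ({α : F | (α ≠ 0 ∧ α ∈ Fqt) ∧ finrank Fq ↥(powerSpace Fq lam m ⊓
          smulSub Fq α (powerSpace Fq lam m)) = j} : Finset F) := by
      intro j
      refine Finset.filter_congr fun α _ => ?_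
      by_cases hαK : α ∈ Fqt
      · by_cases hα : α = 0
        · simp [hα]
        · rw [hin α hα hαK]
          simp only [hα, hαK, ne_eq, not_false_eq_true, true_and]
          omega
      · rw [hout α hαK]
        simp only [hαK, and_false, false_and, iff_false, not_and]
        omega
    have hqz : (q : ℤ) - 1 ≠ 0 := by
      have : (1 : ℤ) < q := by exact_mod_cast hq2
      omega
    have hqq : (q : ℚ) - 1 ≠ 0 := by exact_mod_cast hqz
    refine ⟨fun i hi1 him => ?_, ?_, ?_⟩
    · have h := hwt (t * l + m - i)
      rw [show t * l + m - i = t * l + (m - i) by omega, hset,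
        card_finrank_powerSpace_inf_eq hle hmem (by omega) hi1 (by omega), hq] at h
      rw [show t * l + m - i = t * l + (m - i) by omega]
      zify
      apply mul_left_cancel₀ hqz
      rw [h, show 2 * i + 1 = (2 * i - 1) + 2 by omega, pow_add]
      ring
    · have h := hwt (t * l + 0)
      rw [hset, card_finrank_powerSpace_inf_eq_zero hle hmem hm1 (by omega), hq, hqt,
        add_zero] at h
      rw [eq_div_iff hqq, mul_comm]
      exact_mod_cast h
    · have h := hwt (t * l - 1)
      have hset' : ({α : F | α ≠ 0 ∧ finrank Fq ↥(S ⊓ smulSub Fq α S) = t * l - 1} : Finset F) =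
          ({α : F | ¬ α ∈ Fqt} : Finset F) := by
        refine Finset.filter_congr fun α _ => ?_
        constructor
        · rintro ⟨hα, h⟩ hαK
          rw [hin α hα hαK] at h
          omega
        · exact fun hαK => ⟨fun h => hαK (h ▸ Fqt.zero_mem), hout α hαK⟩
      have hc := Finset.card_filter_add_card_filter_not (s := (Finset.univ : Finset F))
        fun α => α ∈ Fqt
      have hcK : Finset.card {α : F | α ∈ Fqt} = q ^ t := by
        rw [← hqt, Nat.card_eq_fintype_card, Fintype.card_subtype]
      rw [hcK, Finset.card_univ, ← Nat.card_eq_fintype_card, hF] at hc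
      rw [hset'] at h
      have h' : ((q : ℤ) - 1) * (wt Fq S (t * l - 1) : ℤ) = (q : ℤ) ^ n - (q : ℤ) ^ t := by
        rw [h, eq_sub_iff_add_eq']
        exact_mod_cast hc
      rw [eq_div_iff hqq, mul_comm]
      exact_mod_cast h'
  · have hq0 : q = 0 := by rw [← hq]; exact Nat.card_eq_zero_of_infinite
    have hz : ∀ d, d ≠ 0 → d < t * l + m → wt Fq S d = 0 := by
      intro d hd0 hd
      refine wt_eq_zero_of_infinite hle hmem hm1 (by omega) φ hSmem hφb hsurj hdiv hd0 fun hfk => ?_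
      have h1 := natDegree_mul_finrank_le hle hmem (by omega) hφ
      rw [hSbar, ← ht] at h1
      omega
    refine ⟨fun i hi1 him => ?_, ?_, ?_⟩
    · rw [hz _ (by omega) (by omega), hq0, zero_pow (by omega), mul_zero]
    · rw [hz _ (by omega) (by omega), hq0, Nat.cast_zero, zero_pow (by omega), zero_pow (by omega)]
      simp
    · rw [hz _ (by omega) (by omega), hq0, Nat.cast_zero, zero_pow (by omega), zero_pow (by omega)]
      simp
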